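/- Let H be a real Hilbert space, Λ a compact metric space, K : Λ → L(H) a continuous family of compact operators, and T ∈ L(H). Let (Q_n)_{n∈ℕ} be a sequence of orthogonal projections in L(H) converging strongly to the identity I_H. Suppose A ⊆ Λ and C > 0 are such that ‖(T + K_λ)u‖ ≥ 3C‖u‖ for all u ∈ H and all λ ∈ A. Then there exists n₀ ∈ ℕ such that for all n ≥ n₀, all λ ∈ A, and all u ∈ H, one has ‖(T + K_λ − (I_H − Q_n) K_λ (I_H − Q_n)) u‖ ≥ 2C‖u‖. -/

import Mathlib

open Filter

/-- Contractions converging to zero at each point of a compact set do so uniformly on it. -/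
theorem IsCompact.eventually_forall_norm_lt_of_tendsto_zero
    {E F : Type*} [NormedAddCommGroup E] [NormedSpace ℝ E]
    [NormedAddCommGroup F] [NormedSpace ℝ F] {P : ℕ → E →L[ℝ] F} (hP : ∀ n, ‖P n‖ ≤ 1)
    {S : Set E} (hS : IsCompact S) (hlim : ∀ x ∈ S, Tendsto (fun n => P n x) atTop (nhds 0))
    {ε : ℝ} (hε : 0 < ε) : ∀ᶠ n in atTop, ∀ x ∈ S, ‖P n x‖ < ε := by
  refine hS.induction_on (p := fun s => ∀ᶠ n in atTop, ∀ x ∈ s, ‖P n x‖ < ε) ?_ ?_ ?_ ?_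
  · simp
  · intro s t hst ht
    filter_upwards [ht] with n hn x hx using hn x (hst hx)
  · intro s t hs ht
    filter_upwards [hs, ht] with n hns hnt x hx using hx.elim (hns x) (hnt x)
  · intro x hx
    refine ⟨Metric.ball x (ε / 2), mem_nhdsWithin_of_mem_nhds (Metric.ball_mem_nhds x (half_pos hε)),
      ?_⟩
    filter_upwards [(hlim x hx).norm.eventually_lt_const (norm_zero.trans_lt (half_pos hε))]
      with n hn y hy
    have hy' : ‖y - x‖ < ε / 2 := by rwa [← dist_eq_norm]
    calc ‖P n y‖ = ‖P n x + P n (y - x)‖ := by rw [← map_add, add_sub_cancel]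
      _ ≤ ‖P n x‖ + ‖P n (y - x)‖ := norm_add_le _ _
      _ < ε / 2 + ε / 2 := add_lt_add_of_lt_of_le hn
          (((P n).le_of_opNorm_le (hP n) _).trans (by linarith))
      _ = ε := add_halves ε

/-- Composing a compact operator with contractions converging strongly to zero gives operators
converging to zero in norm. -/
theorem IsCompactOperator.tendsto_comp_zero
    {E F G : Type*} [NormedAddCommGroup E] [NormedSpace ℝ E]
    [NormedAddCommGroup F] [NormedSpace ℝ F] [NormedAddCommGroup G] [NormedSpace ℝ G]
    {L : E →L[ℝ] F} (hL : IsCompactOperator L) {P : ℕ → F →L[ℝ] G} (hP : ∀ n, ‖P n‖ ≤ 1)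
    (hlim : ∀ x, Tendsto (fun n => P n x) atTop (nhds 0)) :
    Tendsto (fun n => (P n).comp L) atTop (nhds 0) := by
  rw [NormedAddGroup.tendsto_nhds_zero]
  intro ε hε
  obtain ⟨S, hS, hLS⟩ := IsCompactOperator.image_closedBall_subset_compact (𝕜₁ := ℝ)
    (f := (L : E →ₗ[ℝ] F)) hL 1
  filter_upwards [hS.eventually_forall_norm_lt_of_tendsto_zero hP (fun x _ => hlim x)
    (half_pos hε)] with n hn
  refine lt_of_le_of_lt ?_ (half_lt_self hε)
  refine ContinuousLinearMap.opNorm_le_of_unit_norm (half_pos hε).le fun x hx => ?_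
  exact (hn _ (hLS ⟨x, by simp [hx], rfl⟩)).le

/-- With `K : Λ → L(H)` a norm-continuous family of compact operators on a compact
metric space, `T ∈ L(H)`, and `(Q n)` orthogonal projections converging strongly to the
identity: if `‖(T + K l) u‖ ≥ 3C‖u‖` for all `u ∈ H` and `l ∈ A ⊆ Λ`, then for all
sufficiently large `n`, `‖(T + K l - (1 - Q n) K l (1 - Q n)) u‖ ≥ 2C‖u‖` for all `u` and
all `l ∈ A`. -/
theorem lower_bound_persists_after_removing_corner
    {H Λ : Type*} [NormedAddCommGroup H] [InnerProductSpace ℝ H] [CompleteSpace H]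
    [MetricSpace Λ] [CompactSpace Λ]
    (K : Λ → H →L[ℝ] H) (hKcont : Continuous K)
    (hKcomp : ∀ l : Λ, IsCompactOperator (K l))
    (T : H →L[ℝ] H)
    (Q : ℕ → H →L[ℝ] H)
    (hQsa : ∀ n, IsSelfAdjoint (Q n))
    (hQidem : ∀ n, (Q n).comp (Q n) = Q n)
    (hQstrong : ∀ u : H, Tendsto (fun n => Q n u) atTop (nhds u))
    (A : Set Λ) (C : ℝ) (hC : 0 < C)
    (hbound : ∀ l ∈ A, ∀ u : H, 3 * C * ‖u‖ ≤ ‖(T + K l) u‖) :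
    ∃ n₀ : ℕ, ∀ n ≥ n₀, ∀ l ∈ A, ∀ u : H,
      2 * C * ‖u‖ ≤ ‖((T + K l - (1 - Q n).comp ((K l).comp (1 - Q n)) : H →L[ℝ] H)) u‖ := by
  have hP (n : ℕ) : ‖1 - Q n‖ ≤ 1 :=
    IsStarProjection.norm_le _ (IsStarProjection.one_sub ⟨hQidem n, hQsa n⟩)
  have hlim (u : H) : Tendsto (fun n => (1 - Q n) u) atTop (nhds 0) := by
    simpa using (hQstrong u).const_sub u
  let R (n : ℕ) : (H →L[ℝ] H) →L[ℝ] (H →L[ℝ] H) := ContinuousLinearMap.compL ℝ H H H (1 - Q n)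
  have hR (n : ℕ) : ‖R n‖ ≤ 1 :=
    ContinuousLinearMap.opNorm_le_bound _ zero_le_one fun L =>
      (ContinuousLinearMap.opNorm_comp_le _ _).trans
        (mul_le_mul_of_nonneg_right (hP n) (norm_nonneg L))
  have huniform := (isCompact_range hKcont).eventually_forall_norm_lt_of_tendsto_zero hR
    (by rintro _ ⟨l, rfl⟩; exact (hKcomp l).tendsto_comp_zero hP hlim) hC
  obtain ⟨n₀, hn₀⟩ := eventually_atTop.1 huniform
  refine ⟨n₀, fun n hn l hl u => ?_⟩
  have hcorner : ‖(1 - Q n).comp ((K l).comp (1 - Q n)) u‖ ≤ C * ‖u‖ :=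
    calc ‖((1 - Q n).comp (K l)) ((1 - Q n) u)‖ ≤ C * ‖(1 - Q n) u‖ :=
          ContinuousLinearMap.le_of_opNorm_le _ (hn₀ n hn _ ⟨l, rfl⟩).le _
      _ ≤ C * ‖u‖ := by
          have := (1 - Q n).le_of_opNorm_le (hP n) u
          rw [one_mul] at this
          gcongr
  rw [sub_apply]
  linarith [hbound l hl u, norm_sub_norm_le ((T + K l) u)
    ((1 - Q n).comp ((K l).comp (1 - Q n)) u)]
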